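/- Let f be a 1-periodic continuous function with positive Fourier coefficients (a_n)_{n∈ℤ}, a_n = a_{−n} > 0, decaying so fast that lim_{N→∞} N² (Σ_{n≠0} a_{nN}) / a_{N/2} = 0, and satisfying max_{1≤m≤k} 1/(m²a_m) ≤ C₀/(k²a_k) for all k. Then for all sufficiently large even N, the unique minimizer (up to translation) of the discrete energy E(x_1,…,x_N) = Σ_{m≠k} f(x_m − x_k) over configurations of N points on the circle ℝ/ℤ is the equidistant configuration {(2k−N−1)/(2N)}_{k=1}^N. -/

import Mathlib

open Complex Real Filter
open scoped Real

noncomputable def es {N : ℕ} (z : Fin N → ℂ) (m : ℕ) : ℂ :=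
  ∑ S ∈ Finset.powersetCard m Finset.univ, ∏ i ∈ S, z i

lemma es_newton {N : ℕ} (z : Fin N → ℂ) (m : ℕ) :
    (m : ℂ) * es z m = (-1) ^ (m + 1) *
      ∑ a ∈ Finset.HasAntidiagonal.antidiagonal m with a.1 < m, (-1) ^ a.1 * es z a.1 * ∑ i, z i ^ a.2 := by
  have h := congrArg (MvPolynomial.aeval z) (MvPolynomial.mul_esymm_eq_sum (Fin N) ℂ m)
  simpa [MvPolynomial.esymm, MvPolynomial.psum, es, map_sum, map_prod] using h

lemma es_prod {N : ℕ} (z : Fin N → ℂ) :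
    ∏ i, (Polynomial.X - Polynomial.C (z i)) =
      ∑ j ∈ Finset.range (N + 1), (-1) ^ j * (Polynomial.C (es z j) * Polynomial.X ^ (N - j)) := by
  have h := Multiset.prod_X_sub_X_eq_sum_esymm (Finset.univ.val.map z)
  simp only [Multiset.map_map, Multiset.card_map, Finset.card_val, Finset.card_univ,
    Fintype.card_fin, Finset.esymm_map_val] at h
  exact h

lemma es_compl {N : ℕ} (z : Fin N → ℂ) (hz : ∀ i, ‖z i‖ = 1) (m : ℕ) (hm : m ≤ N) :
    ‖es z (N - m)‖ = ‖es z m‖ := by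
  have h : es z (N - m) = (∏ i, z i) * (starRingEnd ℂ) (es z m) := by
    unfold es
    rw [map_sum, Finset.mul_sum]
    refine Finset.sum_bij' (fun S _ => Sᶜ) (fun S _ => Sᶜ) ?_ ?_ ?_ ?_ ?_
    · intro S hS
      simp only [Finset.mem_powersetCard, Finset.subset_univ, true_and, Finset.card_compl, Fintype.card_fin] at *
      omega
    · intro S hS
      simp only [Finset.mem_powersetCard, Finset.subset_univ, true_and, Finset.card_compl, Fintype.card_fin] at *
      omega
    · simp
    · simp
    · intro S hS
      rw [← Finset.prod_mul_prod_compl S, mul_assoc, map_prod, ← Finset.prod_mul_distrib]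
      rw [Finset.prod_eq_one (s := Sᶜ), mul_one]
      intro i _
      rw [Complex.mul_conj, Complex.normSq_eq_norm_sq, hz]; simp
  rw [h, norm_mul, norm_prod]
  simp [hz]

lemma es_bound {N k : ℕ} (hN : N = 2 * k) (z : Fin N → ℂ) (hz : ∀ i, ‖z i‖ = 1)
    (t : ℝ) (ht : 0 ≤ t) (htk : k * t ≤ 1)
    (hp : ∀ m : ℕ, 1 ≤ m → m ≤ k → ‖∑ i, z i ^ m‖ ≤ m * t) :
    ∀ m : ℕ, 1 ≤ m → m < N → ‖es z m‖ ≤ 3 * t := by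
  have h1 : ∀ m : ℕ, 1 ≤ m → m ≤ k → ‖es z m‖ ≤ t * ∑ i ∈ Finset.range m, ‖es z i‖ := by
    intro m hm hmk
    have h := congrArg norm (es_newton z m)
    rw [norm_mul, norm_mul] at h
    simp only [norm_pow, norm_neg, norm_one, one_pow, one_mul, Complex.norm_natCast] at h
    have hm0 : (0:ℝ) < m := by exact_mod_cast hm
    refine le_of_mul_le_mul_left ?_ hm0
    rw [h]
    refine (norm_sum_le _ _).trans ?_
    rw [Finset.sum_filter, Finset.Nat.sum_antidiagonal_eq_sum_range_succ_mk, Finset.sum_range_succ]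
    simp only [lt_irrefl, if_false, add_zero]
    rw [Finset.mul_sum, Finset.mul_sum]
    refine Finset.sum_le_sum ?_
    intro i hi
    have hi' := Finset.mem_range.1 hi
    rw [if_pos hi', norm_mul, norm_mul]
    simp only [norm_pow, norm_neg, norm_one, one_pow, one_mul]
    have h2 := hp (m - i) (by omega) (by omega)
    have h3 : ((m - i : ℕ) : ℝ) ≤ m := by exact_mod_cast Nat.sub_le m i
    have h4 : ‖∑ j, z j ^ (m - i)‖ ≤ m * t := h2.trans (by gcongr)
    calc _ ≤ ‖es z i‖ * (m * t) := by gcongr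
      _ = _ := by ring
  have h2 : ∀ m : ℕ, m ≤ k → ∑ i ∈ Finset.range (m + 1), ‖es z i‖ ≤ (1 + t) ^ m := by
    intro m
    induction m with
    | zero => intro _; simp [es]
    | succ m ih =>
      intro hm
      rw [Finset.sum_range_succ, pow_succ]
      have := h1 (m + 1) (by omega) hm
      have := ih (by omega)
      nlinarith
  have h3 : ∀ m : ℕ, m ≤ k → (1 + t) ^ m ≤ 3 := by
    intro m hm
    calc (1 + t) ^ m ≤ (Real.exp t) ^ m := by
          gcongr; linarith [Real.add_one_le_exp t]
      _ = Real.exp (m * t) := by rw [Real.exp_nat_mul]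
      _ ≤ Real.exp 1 := by
          apply Real.exp_le_exp.2
          refine le_trans ?_ htk
          gcongr
      _ ≤ 3 := by linarith [Real.exp_one_lt_d9]
  have h4 : ∀ m : ℕ, 1 ≤ m → m ≤ k → ‖es z m‖ ≤ 3 * t := by
    intro m hm hmk
    have ha := h1 m hm hmk
    have hb := h2 (m - 1) (by omega)
    rw [Nat.sub_add_cancel hm] at hb
    have hc := h3 (m - 1) (by omega)
    nlinarith
  intro m hm hmN
  by_cases hmk : m ≤ k
  · exact h4 m hm hmk
  · rw [← es_compl z hz m hmN.le]
    exact h4 _ (by omega) (by omega)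

lemma es_root {N : ℕ} (hN : 1 ≤ N) (z : Fin N → ℂ) (j : Fin N) :
    z j ^ N + ∑ m ∈ Finset.Ico 1 N, (-1) ^ m * (es z m * z j ^ (N - m)) + (-1) ^ N * es z N = 0 := by
  have h := congrArg (Polynomial.eval (z j)) (es_prod z)
  rw [Polynomial.eval_prod, Finset.prod_eq_zero (Finset.mem_univ j) (by simp)] at h
  have h0 : es z 0 = 1 := by simp [es]
  rw [Polynomial.eval_finsetSum, Finset.sum_range_succ, Finset.range_eq_Ico,
    Finset.sum_eq_sum_Ico_succ_bot (by omega)] at h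
  simp [h0] at h
  rw [h]

lemma near {N k : ℕ} (hk : 1 ≤ k) (hN : N = 2 * k) (z : Fin N → ℂ) (hz : ∀ i, ‖z i‖ = 1)
    (t : ℝ) (ht : 0 ≤ t) (htk : k * t ≤ 1)
    (hp : ∀ m : ℕ, 1 ≤ m → m ≤ k → ‖∑ i, z i ^ m‖ ≤ m * t) :
    ∀ i j, ‖z i ^ N - z j ^ N‖ ≤ 12 * (k * t) := by
  have hb := es_bound hN z hz t ht htk hp
  have h1 : ∀ j, ‖z j ^ N + (-1) ^ N * es z N‖ ≤ 6 * (k * t) := by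
    intro j
    have h := es_root (by omega) z j
    have : z j ^ N + (-1) ^ N * es z N = - ∑ m ∈ Finset.Ico 1 N, (-1) ^ m * (es z m * z j ^ (N - m)) := by
      linear_combination h
    rw [this, norm_neg]
    refine (norm_sum_le _ _).trans ?_
    have : ∑ m ∈ Finset.Ico 1 N, ‖(-1) ^ m * (es z m * z j ^ (N - m))‖ ≤ ∑ m ∈ Finset.Ico 1 N, 3 * t := by
      refine Finset.sum_le_sum ?_
      intro m hm
      rw [Finset.mem_Ico] at hm
      simpa [hz] using hb m hm.1 hm.2
    refine this.trans ?_
    rw [Finset.sum_const, Nat.card_Ico, nsmul_eq_mul]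
    have : ((N - 1 : ℕ) : ℝ) ≤ 2 * k := by
      exact_mod_cast (by omega : N - 1 ≤ 2 * k)
    nlinarith
  intro i j
  have : z i ^ N - z j ^ N = (z i ^ N + (-1) ^ N * es z N) - (z j ^ N + (-1) ^ N * es z N) := by ring
  rw [this]
  refine (norm_sub_le _ _).trans ?_
  linarith [h1 i, h1 j]

lemma inj {N k : ℕ} (hk : 1 ≤ k) (hN : N = 2 * k) (z : Fin N → ℂ) (hz : ∀ i, ‖z i‖ = 1)
    (hp : ∀ m : ℕ, 1 ≤ m → m ≤ k → ∑ i, z i ^ m = 0) :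
    Function.Injective z := by
  have hb := es_bound hN z hz 0 le_rfl (by simp) (by intro m h1 h2; simp [hp m h1 h2])
  have h := es_prod z
  rw [Finset.sum_range_succ, Finset.range_eq_Ico,
    Finset.sum_eq_sum_Ico_succ_bot (by omega), Finset.sum_eq_zero] at h
  · rw [← Polynomial.separable_prod_X_sub_C_iff, h]
    have h0 : es z 0 = 1 := by simp [es]
    have hev : Even N := ⟨k, by omega⟩
    have hne : es z N ≠ 0 := by
      intro h
      have := es_compl z hz 0 (by omega)
      rw [Nat.sub_zero, h, h0] at this
      simp at this
    have := Polynomial.separable_X_pow_sub_C (n := N) (-es z N)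
      (by exact_mod_cast (by omega : N ≠ 0)) (by simpa using hne)
    simpa [h0, hev.neg_one_pow] using this
  · intro m hm
    rw [Finset.mem_Ico] at hm
    have := hb m (by omega) hm.2
    simp at this
    simp [this]

lemma pow_sub_pow_norm (u v : ℂ) (hu : ‖u‖ = 1) (hv : ‖v‖ = 1) (n : ℕ) :
    ‖u ^ n - v ^ n‖ ≤ n * ‖u - v‖ := by
  induction n with
  | zero => simp
  | succ n ih =>
    have : u ^ (n + 1) - v ^ (n + 1) = u ^ n * (u - v) + (u ^ n - v ^ n) * v := by ring
    rw [this]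
    refine (norm_add_le _ _).trans ?_
    rw [norm_mul, norm_mul, norm_pow, hu, hv, one_pow]
    push_cast
    linarith

lemma defect {N : ℕ} (w : Fin N → ℂ) (hw : ∀ i, ‖w i‖ = 1) (d : ℝ)
    (hd : ∀ i j, ‖w i - w j‖ ≤ d) :
    (N : ℝ) ^ 2 - ‖∑ i, w i‖ ^ 2 ≤ N ^ 2 * d ^ 2 / 2 := by
  have h1 : ∀ i j, ‖w i - w j‖ ^ 2 = 2 - 2 * (w i * (starRingEnd ℂ) (w j)).re := by
    intro i j
    rw [← Complex.normSq_eq_norm_sq, Complex.normSq_sub, Complex.normSq_eq_norm_sq,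
      Complex.normSq_eq_norm_sq, hw, hw]; ring
  have h2 : ‖∑ i, w i‖ ^ 2 = ∑ i, ∑ j, (w i * (starRingEnd ℂ) (w j)).re := by
    rw [← Complex.normSq_eq_norm_sq]
    have : ((Complex.normSq (∑ i, w i) : ℝ) : ℂ) = ∑ i, ∑ j, (w i * (starRingEnd ℂ) (w j)) := by
      rw [← Complex.mul_conj, map_sum, Finset.sum_mul_sum]
    have := congrArg Complex.re this
    simpa only [Complex.ofReal_re, Complex.re_sum] using this
  have h3 : ∑ i, ∑ j, ‖w i - w j‖ ^ 2 = 2 * ((N : ℝ) ^ 2 - ‖∑ i, w i‖ ^ 2) := by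
    simp only [h1, Finset.sum_sub_distrib, ← Finset.mul_sum, h2]
    simp
    ring
  have h4 : ∑ i : Fin N, ∑ j : Fin N, ‖w i - w j‖ ^ 2 ≤ ∑ i : Fin N, ∑ j : Fin N, d ^ 2 := by
    refine Finset.sum_le_sum fun i _ => Finset.sum_le_sum fun j _ => ?_
    exact pow_le_pow_left₀ (norm_nonneg _) (hd i j) 2
  simp at h4
  nlinarith

noncomputable def Sx {N : ℕ} (x : Fin N → ℝ) (n : ℤ) : ℂ :=
  ∑ j, Complex.exp (2 * π * Complex.I * n * (x j : ℂ))

lemma Sx_norm_le {N : ℕ} (x : Fin N → ℝ) (n : ℤ) : ‖Sx x n‖ ≤ N := by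
  refine (norm_sum_le _ _).trans ?_
  have : ∀ j, ‖Complex.exp (2 * π * Complex.I * n * (x j : ℂ))‖ = 1 := by
    intro j
    have : (2 * π * Complex.I * n * (x j : ℂ)) = ((2 * π * n * x j : ℝ) : ℂ) * Complex.I := by
      push_cast; ring
    rw [this, Complex.norm_exp_ofReal_mul_I]
  simp [this]

lemma Sx_nat {N : ℕ} (x : Fin N → ℝ) (n : ℕ) :
    Sx x n = ∑ j, Complex.exp (2 * π * Complex.I * (x j : ℂ)) ^ n := by
  unfold Sx
  refine Finset.sum_congr rfl fun j _ => ?_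
  rw [← Complex.exp_nat_mul]
  congr 1; push_cast; ring

lemma Sx_neg {N : ℕ} (x : Fin N → ℝ) (n : ℤ) : Sx x (-n) = (starRingEnd ℂ) (Sx x n) := by
  unfold Sx
  rw [map_sum]
  refine Finset.sum_congr rfl fun j _ => ?_
  rw [← Complex.exp_conj]
  congr 1
  simp only [map_mul, Complex.conj_I, Complex.conj_ofReal, map_ofNat, map_intCast]
  push_cast; ring

lemma Sx_abs {N : ℕ} (x : Fin N → ℝ) (n : ℤ) : ‖Sx x n‖ = ‖Sx x (n.natAbs : ℤ)‖ := by
  rcases Int.natAbs_eq n with h | h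
  · rw [← h]
  · conv_lhs => rw [h, Sx_neg]
    simp

lemma Sx_equi {N : ℕ} (hN : 1 ≤ N) (n : ℤ) (hn : ¬ (N : ℤ) ∣ n) :
    Sx (fun j : Fin N => (j : ℝ) / N) n = 0 := by
  have hN0 : (N : ℂ) ≠ 0 := by exact_mod_cast (by omega : N ≠ 0)
  set q : ℂ := Complex.exp (2 * π * Complex.I * n / N) with hq
  have h1 : Sx (fun j : Fin N => (j : ℝ) / N) n = ∑ j ∈ Finset.range N, q ^ j := by
    rw [Finset.sum_range]
    unfold Sx
    refine Finset.sum_congr rfl fun j _ => ?_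
    rw [hq, ← Complex.exp_nat_mul]
    congr 1; push_cast; ring
  have hqN : q ^ N = 1 := by
    rw [hq, ← Complex.exp_nat_mul, Complex.exp_eq_one_iff]
    exact ⟨n, by field_simp⟩
  have hq1 : q ≠ 1 := by
    intro h
    rw [hq, Complex.exp_eq_one_iff] at h
    obtain ⟨r, hr⟩ := h
    apply hn
    refine ⟨r, ?_⟩
    have h2 : (2 * π * Complex.I : ℂ) ≠ 0 := Complex.two_pi_I_ne_zero
    have h3 : (n : ℂ) = N * r := by
      apply mul_left_cancel₀ h2
      rw [div_eq_iff hN0] at hr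
      linear_combination hr
    exact_mod_cast h3
  rw [h1]
  have := geom_sum_mul q N
  rw [hqN, sub_self, mul_eq_zero] at this
  exact this.resolve_right (sub_ne_zero.2 hq1)

lemma parseval (f : ℝ → ℝ) (a : ℤ → ℝ) (hpos : ∀ n : ℤ, 0 < a n)
    (hsum : Summable a)
    (hF : ∀ x : ℝ, (f x : ℂ) = ∑' n : ℤ, (a n : ℂ) * Complex.exp (2 * π * Complex.I * n * x))
    {N : ℕ} (x : Fin N → ℝ) :
    HasSum (fun n : ℤ => a n * ‖Sx x n‖ ^ 2) (∑ m, ∑ k, f (x m - x k)) := by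
  have h1 : ∀ y : ℝ, HasSum (fun n : ℤ => (a n : ℂ) * Complex.exp (2 * π * Complex.I * n * y)) (f y) := by
    intro y
    rw [hF y]
    refine Summable.hasSum ?_
    refine Summable.of_norm_bounded hsum ?_
    intro n
    have : (2 * π * Complex.I * n * (y : ℂ)) = ((2 * π * n * y : ℝ) : ℂ) * Complex.I := by
      push_cast; ring
    rw [this, norm_mul, Complex.norm_exp_ofReal_mul_I, mul_one, Complex.norm_real,
      Real.norm_of_nonneg (hpos n).le]
  have h2 : HasSum (fun n : ℤ => ∑ m, ∑ k, (a n : ℂ) * Complex.exp (2 * π * Complex.I * n * ((x m - x k : ℝ) : ℂ)))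
      (∑ m, ∑ k, (f (x m - x k) : ℂ)) :=
    hasSum_sum fun m _ => hasSum_sum fun k _ => h1 _
  rw [← Complex.hasSum_ofReal]
  push_cast
  convert h2 using 1
  funext n
  have h3 : ((‖Sx x n‖ : ℂ)) ^ 2 = Sx x n * (Sx x (-n)) := by
    rw [Sx_neg, Complex.mul_conj, Complex.normSq_eq_norm_sq]; push_cast; rfl
  rw [h3]
  unfold Sx
  rw [Finset.sum_mul_sum, Finset.mul_sum]
  refine Finset.sum_congr rfl fun m _ => ?_
  rw [Finset.mul_sum]
  refine Finset.sum_congr rfl fun k _ => ?_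
  rw [← Complex.exp_add]
  congr 2
  push_cast; ring

lemma main_ineq (f : ℝ → ℝ) (a : ℤ → ℝ) (hpos : ∀ n : ℤ, 0 < a n)
    (hsum : Summable a)
    (hF : ∀ x : ℝ, (f x : ℂ) = ∑' n : ℤ, (a n : ℂ) * Complex.exp (2 * π * Complex.I * n * x))
    {N k : ℕ} (hN : 1 ≤ N) (hkN : k < N) (x : Fin N → ℝ)
    (hx : ∀ z : Fin N → ℝ, ∑ m, ∑ k, f (x m - x k) ≤ ∑ m, ∑ k, f (z m - z k))
    (κ : ℝ)
    (hκ : ∀ n : ℤ, n ≠ 0 → a (n * N) * ((N : ℝ) ^ 2 - ‖Sx x (n * N)‖ ^ 2) ≤ κ * (1 / (n : ℝ) ^ 2)) :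
    ∑ m ∈ Finset.Icc (1 : ℤ) k, a m * ‖Sx x m‖ ^ 2 ≤ κ * ∑' n : ℤ, 1 / (n : ℝ) ^ 2 := by
  set z : Fin N → ℝ := fun j => (j : ℝ) / N with hz
  have hb := (parseval f a hpos hsum hF z).sub (parseval f a hpos hsum hF x)
  have hS : HasSum (fun n : ℤ => κ * (1 / (n : ℝ) ^ 2)) (κ * ∑' n : ℤ, 1 / (n : ℝ) ^ 2) :=
    (Real.summable_one_div_int_pow.2 (by norm_num)).hasSum.mul_left κ
  have hNz : (N : ℤ) ≠ 0 := by omega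
  have hg : HasSum (fun n : ℤ => if (N : ℤ) ∣ n then κ * (1 / ((n / N : ℤ) : ℝ) ^ 2) else 0)
      (κ * ∑' n : ℤ, 1 / (n : ℝ) ^ 2) := by
    have hi : Function.Injective (fun n : ℤ => n * (N : ℤ)) := mul_left_injective₀ hNz
    rw [← hi.hasSum_iff]
    · convert hS using 1
      funext n
      simp only [Function.comp, if_pos (Dvd.intro_left n rfl : (N : ℤ) ∣ n * N), Int.mul_ediv_cancel _ hNz]
    · intro n hn
      rw [if_neg]
      rintro ⟨r, hr⟩
      exact hn ⟨r, by simp only [hr]; ring⟩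
  have hh : HasSum (fun n : ℤ => if n ∈ Finset.Icc (1 : ℤ) k then a n * ‖Sx x n‖ ^ 2 else 0)
      (∑ m ∈ Finset.Icc (1 : ℤ) k, a m * ‖Sx x m‖ ^ 2) := by
    have := hasSum_sum_of_ne_finset_zero (L := SummationFilter.unconditional ℤ) (f := fun n : ℤ => if n ∈ Finset.Icc (1 : ℤ) k then a n * ‖Sx x n‖ ^ 2 else 0)
      (s := Finset.Icc (1 : ℤ) k) (fun n hn => if_neg hn)
    convert this using 1
    exact Finset.sum_congr rfl fun n hn => (if_pos hn).symm
  have := hasSum_le (fun n => ?_) hb (hg.sub hh)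
  · linarith [hx z]
  · have hnn : 0 ≤ a n * ‖Sx x n‖ ^ 2 := by have := hpos n; positivity
    by_cases hd : (N : ℤ) ∣ n
    · rw [if_pos hd]
      have hni : n ∉ Finset.Icc (1 : ℤ) k := by
        rw [Finset.mem_Icc]
        rintro ⟨h1, h2⟩
        have := Int.le_of_dvd (by omega) hd
        omega
      rw [if_neg hni, sub_zero]
      obtain ⟨r, rfl⟩ := hd
      rw [Int.mul_ediv_cancel_left _ hNz, mul_comm (N : ℤ) r]
      by_cases hr : r = 0
      · subst hr
        simp [Sx]
      · refine le_trans ?_ (hκ r hr)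
        rw [mul_sub]
        have := hpos (r * N)
        have h3 := Sx_norm_le z (r * N)
        gcongr
    · rw [if_neg hd, hz, Sx_equi hN n hd]
      split_ifs
      · simp
      · simp; linarith [hnn]

lemma final_arr {N : ℕ} (hN : 1 ≤ N) (x : Fin N → ℝ)
    (hinj : Function.Injective (fun j => Complex.exp (2 * π * Complex.I * (x j : ℂ))))
    (heq : ∀ i j, Complex.exp (2 * π * Complex.I * (x i : ℂ)) ^ N = Complex.exp (2 * π * Complex.I * (x j : ℂ)) ^ N) :
    ∃ c : ℝ, ∃ σ : Equiv.Perm (Fin N), ∀ k : Fin N,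
          ∃ j : ℤ, x (σ k) = (2 * ((k : ℕ) + 1 : ℝ) - N - 1) / (2 * N) + c + j := by
  have hNR : (N : ℝ) ≠ 0 := by exact_mod_cast (by omega : N ≠ 0)
  have hNz : (0 : ℤ) < N := by omega
  set i0 : Fin N := ⟨0, by omega⟩
  have h1 : ∀ j, ∃ r : ℤ, x j = x i0 + r / N := by
    intro j
    have h := heq j i0
    rw [← Complex.exp_nat_mul, ← Complex.exp_nat_mul, Complex.exp_eq_exp_iff_exists_int] at h
    obtain ⟨r, hr⟩ := h
    refine ⟨r, ?_⟩
    have h3 : (N * x j : ℂ) = N * x i0 + r := by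
      apply mul_left_cancel₀ Complex.two_pi_I_ne_zero
      linear_combination hr
    have h4 : (N * x j : ℝ) = N * x i0 + r := by exact_mod_cast h3
    field_simp
    linarith
  choose r hr using h1
  have hlt : ∀ j, (r j % N).toNat < N := by
    intro j
    have h1 := Int.emod_nonneg (r j) hNz.ne'
    have h2 := Int.emod_lt_of_pos (r j) hNz
    omega
  have hdec : ∀ j, ∃ s : ℤ, x j = x i0 + ((r j % N).toNat : ℝ) / N + s := by
    intro j
    refine ⟨r j / N, ?_⟩
    rw [hr j]
    have h1 := Int.toNat_of_nonneg (Int.emod_nonneg (r j) hNz.ne')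
    have h2 := Int.emod_add_mul_ediv (r j) N
    have h3 : (r j : ℝ) = ((r j % N).toNat : ℝ) + N * ((r j / N : ℤ) : ℝ) := by
      have : (((r j % N).toNat : ℤ) : ℝ) + N * ((r j / N : ℤ) : ℝ) = r j := by
        rw [h1]; exact_mod_cast h2
      rw [← this]; push_cast; ring
    rw [h3]
    field_simp
    ring
  let g : Fin N → Fin N := fun j => ⟨(r j % N).toNat, hlt j⟩
  have hg : Function.Injective g := by
    intro i j hij
    have hij' : (r i % N).toNat = (r j % N).toNat := congrArg Fin.val hij
    obtain ⟨s, hs⟩ := hdec i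
    obtain ⟨s', hs'⟩ := hdec j
    apply hinj
    simp only
    rw [Complex.exp_eq_exp_iff_exists_int]
    refine ⟨s - s', ?_⟩
    have : x i = x j + (s - s') := by rw [hs, hs', hij']; ring
    rw [this]; push_cast; ring
  let e := Equiv.ofBijective g (Finite.injective_iff_bijective.1 hg)
  refine ⟨x i0 - (1 - N) / (2 * N), e.symm, ?_⟩
  intro k
  obtain ⟨s, hs⟩ := hdec (e.symm k)
  refine ⟨s, ?_⟩
  have h1 : ((r (e.symm k) % N).toNat) = (k : ℕ) := by
    have : e (e.symm k) = k := e.apply_symm_apply k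
    exact congrArg Fin.val this
  rw [hs, h1]
  field_simp
  ring

lemma decay_coeff (a : ℤ → ℝ) (hsym : ∀ n : ℤ, a (-n) = a n)
    (hpos : ∀ n : ℤ, 0 < a n) (hsum : Summable a)
    (hdecay : Tendsto
      (fun L : ℕ => ((2 * (L : ℝ)) ^ 2
          * ∑' n : ℤ, (if n = 0 then 0 else a (n * (2 * (L : ℤ))))) / a (L : ℤ))
      atTop (nhds 0))
    (C₀ : ℝ)
    (hdouble : ∀ k : ℕ, 1 ≤ k → ∀ m : ℕ, 1 ≤ m → m ≤ k →
      1 / ((m : ℝ) ^ 2 * a (m : ℤ)) ≤ C₀ / ((k : ℝ) ^ 2 * a (k : ℤ)))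
    (ε : ℝ) (hε : 0 < ε) :
    ∃ L₀ : ℕ, ∀ k : ℕ, L₀ ≤ k → 1 ≤ k → ∀ n : ℤ, n ≠ 0 →
      (n : ℝ) ^ 2 * ((2 * k : ℕ) : ℝ) ^ 2 * a (n * ((2 * k : ℕ) : ℤ)) ≤ ε * C₀ * a k * (1 / (n : ℝ) ^ 2) := by
  obtain ⟨L₀, hL₀⟩ := eventually_atTop.1 (hdecay.eventually (gt_mem_nhds hε))
  refine ⟨L₀, fun k hk hk1 n hn => ?_⟩
  have key : ∀ L : ℕ, L₀ ≤ L → 1 ≤ L → (2 * (L : ℝ)) ^ 2 * a (2 * (L : ℤ)) ≤ ε * a L := by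
    intro L hL hL1
    have h := hL₀ L hL
    rw [div_lt_iff₀ (hpos _)] at h
    refine le_trans ?_ h.le
    have hi : Function.Injective (fun n : ℤ => n * (2 * (L : ℤ))) :=
      mul_left_injective₀ (by omega)
    have hs : Summable (fun n : ℤ => if n = 0 then 0 else a (n * (2 * (L : ℤ)))) := by
      refine Summable.of_nonneg_of_le ?_ ?_ (hsum.comp_injective hi)
      · intro n; split_ifs; exacts [le_rfl, (hpos _).le]
      · intro n; simp only [Function.comp]; split_ifs; exacts [(hpos _).le, le_rfl]
    have := hs.le_tsum 1 (fun n _ => by split_ifs; exacts [le_rfl, (hpos _).le])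
    simp only [one_ne_zero, if_false, one_mul] at this
    gcongr
  have hn1 : 1 ≤ n.natAbs := by omega
  have h1 : k ≤ n.natAbs * k := Nat.le_mul_of_pos_left k hn1
  have h2 := key (n.natAbs * k) (by omega) (by omega)
  have h3 : a (2 * ((n.natAbs * k : ℕ) : ℤ)) = a (n * ((2 * k : ℕ) : ℤ)) := by
    rcases Int.natAbs_eq n with h | h
    · conv_rhs => rw [h]
      congr 1; push_cast; ring
    · conv_rhs => rw [h]
      rw [← hsym]
      congr 1; push_cast; ring
  have h4 := hdouble (n.natAbs * k) (by omega) k hk1 h1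
  have hk0 : (0 : ℝ) < k := by exact_mod_cast hk1
  have hn0 : (0 : ℝ) < n.natAbs := by exact_mod_cast hn1
  have hnsq : (n : ℝ) ^ 2 = (n.natAbs : ℝ) ^ 2 := by
    rw [Nat.cast_natAbs]; push_cast; rw [sq_abs]
  rw [h3] at h2
  rw [hnsq]
  set ν : ℝ := (n.natAbs : ℝ)
  have ha1 := hpos ((n.natAbs * k : ℕ) : ℤ)
  have ha2 := hpos k
  rw [div_le_div_iff₀ (by positivity) (by positivity)] at h4
  have h5 : ν ^ 2 * a ((n.natAbs * k : ℕ) : ℤ) ≤ C₀ * a k := by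
    have hc : ((n.natAbs * k : ℕ) : ℝ) = ν * k := by push_cast; rfl
    rw [hc] at h4
    have : (0:ℝ) < k ^ 2 := by positivity
    refine le_of_mul_le_mul_left ?_ this
    linarith
  have hc : ((n.natAbs * k : ℕ) : ℝ) = ν * k := by push_cast; rfl
  rw [hc] at h2
  rw [mul_one_div, le_div_iff₀ (by positivity)]
  push_cast at h2 ⊢
  calc _ = ν ^ 2 * ((2 * (ν * k)) ^ 2 * a (n * (2 * k))) := by ring
    _ ≤ ν ^ 2 * (ε * a (n.natAbs * k)) := mul_le_mul_of_nonneg_left (by simpa using h2) (by positivity)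
    _ = ε * (ν ^ 2 * a (n.natAbs * k)) := by ring
    _ ≤ ε * (C₀ * a k) :=
      mul_le_mul_of_nonneg_left (by simpa using h5) hε.le
    _ = _ := by ring

theorem stmt_19 (f : ℝ → ℝ) (a : ℤ → ℝ)
    (hcont : Continuous f)
    (hper : ∀ x : ℝ, f (x + 1) = f x)
    (hsym : ∀ n : ℤ, a (-n) = a n)
    (hpos : ∀ n : ℤ, 0 < a n)
    (hsum : Summable a)
    (hF : ∀ x : ℝ, (f x : ℂ) = ∑' n : ℤ, (a n : ℂ) * Complex.exp (2 * π * Complex.I * n * x))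
    (hdecay : Tendsto
      (fun L : ℕ => ((2 * (L : ℝ)) ^ 2
          * ∑' n : ℤ, (if n = 0 then 0 else a (n * (2 * (L : ℤ))))) / a (L : ℤ))
      atTop (nhds 0))
    (C₀ : ℝ) (hC₀ : 0 < C₀)
    (hdouble : ∀ k : ℕ, 1 ≤ k → ∀ m : ℕ, 1 ≤ m → m ≤ k →
      1 / ((m : ℝ) ^ 2 * a (m : ℤ)) ≤ C₀ / ((k : ℝ) ^ 2 * a (k : ℤ)))
    (E : (N : ℕ) → (Fin N → ℝ) → ℝ)
    (hE : ∀ (N : ℕ) (x : Fin N → ℝ),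
      E N x = ∑ m, ∑ k, if m ≠ k then f (x m - x k) else 0) :
    ∃ N₀ : ℕ, ∀ N : ℕ, N₀ ≤ N → Even N →
      ∀ x : Fin N → ℝ, (∀ z : Fin N → ℝ, E N x ≤ E N z) →
        ∃ c : ℝ, ∃ σ : Equiv.Perm (Fin N), ∀ k : Fin N,
          ∃ j : ℤ, x (σ k) = (2 * ((k : ℕ) + 1 : ℝ) - N - 1) / (2 * N) + c + j := by
  set K : ℝ := ∑' n : ℤ, 1 / (n : ℝ) ^ 2 with hK
  have hKpos : 0 < K := by
    have hs : Summable (fun n : ℤ => 1 / (n : ℝ) ^ 2) :=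
      Real.summable_one_div_int_pow.2 (by norm_num)
    have := hs.le_tsum 1 (fun n _ => by positivity)
    norm_num at this
    rw [hK]
    norm_num
    linarith
  set ε : ℝ := 1 / (100 * C₀ ^ 2 * K) with hεdef
  have hε : 0 < ε := by positivity
  have hεK : ε * C₀ ^ 2 * K = 1 / 100 := by rw [hεdef]; field_simp
  obtain ⟨L₀, hL₀⟩ := decay_coeff a hsym hpos hsum hdecay C₀ hdouble ε hε
  refine ⟨2 * L₀ + 2, fun N hN hev x hx => ?_⟩
  obtain ⟨k, hk⟩ := hev
  have hNk : N = 2 * k := by omega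
  have hk1 : 1 ≤ k := by omega
  have hkL : L₀ ≤ k := by omega
  have hd := hL₀ k hkL hk1
  rw [← hNk] at hd
  have hx' : ∀ z : Fin N → ℝ, ∑ m, ∑ k, f (x m - x k) ≤ ∑ m, ∑ k, f (z m - z k) := by
    have hE' : ∀ y : Fin N → ℝ, ∑ m, ∑ k, f (y m - y k) = E N y + N * f 0 := by
      intro y
      rw [hE]
      have : ∀ m, ∑ k, f (y m - y k) = (∑ k, if m ≠ k then f (y m - y k) else 0) + f 0 := by
        intro m
        rw [← Finset.add_sum_erase _ _ (Finset.mem_univ m),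
          ← Finset.add_sum_erase (f := fun k => if m ≠ k then f (y m - y k) else 0) _ (Finset.mem_univ m)]
        simp only [sub_self, ne_eq, not_true_eq_false, if_false, zero_add]
        rw [add_comm]
        congr 1
        refine Finset.sum_congr rfl fun j hj => ?_
        rw [if_pos (Finset.ne_of_mem_erase hj).symm]
      simp only [this, Finset.sum_add_distrib]
      simp
    intro z
    rw [hE', hE']
    linarith [hx z]
  have hak := hpos k
  have hk0 : (0 : ℝ) < k := by exact_mod_cast hk1
  have MI := fun κ h => main_ineq f a hpos hsum hF (k := k) (by omega) (by omega) x hx' κ h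
  rw [← hK] at MI
  set A : ℝ := ∑ m ∈ Finset.Icc (1 : ℤ) k, a m * ‖Sx x m‖ ^ 2 with hA
  have hterm : ∀ m ∈ Finset.Icc (1 : ℤ) k, 0 ≤ a m * ‖Sx x m‖ ^ 2 := by
    intro m _; have := hpos m; positivity
  have hA0 : 0 ≤ A := Finset.sum_nonneg hterm
  have hA1 : A ≤ ε * C₀ * a k * K := by
    refine MI _ fun n hn => ?_
    refine le_trans ?_ (hd n hn)
    have h1 := hpos (n * N)
    have h2 : (1 : ℝ) ≤ (n : ℝ) ^ 2 := by
      have : (1 : ℤ) ≤ n ^ 2 := by have := sq_pos_of_ne_zero hn; omega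
      exact_mod_cast this
    have h3 : (N : ℝ) ^ 2 - ‖Sx x (n * N)‖ ^ 2 ≤ 1 * N ^ 2 := by
      linarith [sq_nonneg ‖Sx x (n * N)‖]
    calc _ ≤ a (n * N) * (1 * N ^ 2) := by gcongr
      _ ≤ a (n * N) * ((n : ℝ) ^ 2 * N ^ 2) := by gcongr
      _ = _ := by ring
  set τ : ℝ := √(C₀ * A / a k) with hτ
  have hτ0 : 0 ≤ τ := Real.sqrt_nonneg _
  have hτsq : τ ^ 2 = C₀ * A / a k := Real.sq_sqrt (by positivity)
  have hτ1 : τ ≤ 1 := by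
    rw [hτ, Real.sqrt_le_iff]
    refine ⟨zero_le_one, ?_⟩
    rw [one_pow, div_le_one hak]
    have : C₀ * A ≤ C₀ * (ε * C₀ * a k * K) := by gcongr
    have h2 : C₀ * (ε * C₀ * a k * K) = (ε * C₀ ^ 2 * K) * a k := by ring
    rw [h2, hεK] at this
    linarith
  set z : Fin N → ℂ := fun j => Complex.exp (2 * π * Complex.I * (x j : ℂ)) with hzdef
  have hz : ∀ i, ‖z i‖ = 1 := by
    intro j
    have : (2 * π * Complex.I * (x j : ℂ)) = ((2 * π * x j : ℝ) : ℂ) * Complex.I := by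
      push_cast; ring
    simp only [hzdef]
    rw [this, Complex.norm_exp_ofReal_mul_I]
  have hp : ∀ m : ℕ, 1 ≤ m → m ≤ k → ‖∑ i, z i ^ m‖ ≤ m * (τ / k) := by
    intro m hm hmk
    rw [← Sx_nat]
    have h1 : a m * ‖Sx x m‖ ^ 2 ≤ A :=
      Finset.single_le_sum (f := fun m : ℤ => a m * ‖Sx x m‖ ^ 2) hterm
        (Finset.mem_Icc.2 ⟨by exact_mod_cast hm, by exact_mod_cast hmk⟩)
    have h2 := hdouble k hk1 m hm hmk
    have ham := hpos m
    have hm0 : (0 : ℝ) < m := by exact_mod_cast hm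
    rw [div_le_div_iff₀ (by positivity) (by positivity)] at h2
    refine (sq_le_sq₀ (norm_nonneg _) (by positivity)).1 ?_
    rw [mul_pow, div_pow, hτsq, div_div, mul_div_assoc', le_div_iff₀ (by positivity)]
    have h3 : ‖Sx x m‖ ^ 2 * (1 * (k ^ 2 * a k)) ≤ ‖Sx x m‖ ^ 2 * (C₀ * (m ^ 2 * a m)) := by gcongr
    have h4 : C₀ * m ^ 2 * (a m * ‖Sx x m‖ ^ 2) ≤ C₀ * m ^ 2 * A := by gcongr
    linarith
  have hkt : k * (τ / k) = τ := by field_simp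
  have hnear := near hk1 hNk z hz (τ / k) (by positivity) (by rw [hkt]; exact hτ1) hp
  rw [hkt] at hnear
  have hA2 : A ≤ 72 * τ ^ 2 * (ε * C₀ * a k) * K := by
    refine MI _ fun n hn => ?_
    rw [mul_assoc (72 * τ ^ 2)]
    refine le_trans ?_ (mul_le_mul_of_nonneg_left (hd n hn) (by positivity))
    have hdef := defect (fun i => (z i ^ N) ^ n.natAbs) (by intro i; simp [hz]) (n.natAbs * (12 * τ)) (by
      intro i j
      refine (pow_sub_pow_norm _ _ (by simp [hz]) (by simp [hz]) _).trans ?_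
      gcongr
      exact hnear i j)
    have hS : ‖Sx x (n * N)‖ = ‖∑ i, (z i ^ N) ^ n.natAbs‖ := by
      rw [Sx_abs, Sx_nat]
      congr 1
      refine Finset.sum_congr rfl fun i _ => ?_
      rw [← pow_mul, Int.natAbs_mul, Int.natAbs_natCast, mul_comm n.natAbs N]
    rw [hS]
    have hnsq : (n : ℝ) ^ 2 = (n.natAbs : ℝ) ^ 2 := by
      rw [Nat.cast_natAbs]; push_cast; rw [sq_abs]
    have h1 := hpos (n * N)
    calc _ ≤ a (n * N) * (N ^ 2 * (n.natAbs * (12 * τ)) ^ 2 / 2) := by gcongr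
      _ = _ := by rw [hnsq]; ring
  have hAz : A = 0 := by
    have : 72 * τ ^ 2 * (ε * C₀ * a k) * K = 72 * (ε * C₀ ^ 2 * K) * A := by
      rw [hτsq]; field_simp
    rw [this, hεK] at hA2
    linarith
  have hτz : τ = 0 := by rw [hτ, hAz]; simp
  refine final_arr (by omega) x ?_ ?_
  · refine inj hk1 hNk z hz ?_
    intro m h1 h2
    have := hp m h1 h2
    rw [hτz] at this
    simpa using this
  · intro i j
    have := hnear i j
    rw [hτz] at this
    simpa [sub_eq_zero] using this
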